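/- Suppose (A,C) is observable with lag ℓ (the smallest integer l such that col(C, CA, …, CA^{l−1}) has rank n), L_p ≥ ℓ, and the offline data (u_d, y_d) of length N_d is a noise-free trajectory of the system. Let (u, y) be any length-L trajectory of the system, with past parts u_p, y_p (its first L_p samples), future input u_f (last L_f input samples) and future output y_f (last L_f output samples). Then: (i) for every g ∈ ℝ^{N_d−L+1} satisfying Z_p g = col(u_p, y_p) and U_f g = u_f, one has Y_f g = y_f; (ii) the future output is uniquely determined, i.e. any two length-L trajectories of the system with the same past inputs, past outputs, and future inputs have the same future outputs. -/

import Mathlib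

open Matrix

/-- A length-`T` input/output trajectory of the LTI system
`x(t+1) = A x(t) + B u(t)`, `y(t) = C x(t) + D u(t)` (time starts at `t = 0`). -/
def IsTrajectory {n mdim pdim : ℕ}
    (A : Matrix (Fin n) (Fin n) ℝ) (B : Matrix (Fin n) (Fin mdim) ℝ)
    (C : Matrix (Fin pdim) (Fin n) ℝ) (D : Matrix (Fin pdim) (Fin mdim) ℝ)
    (T : ℕ) (u : ℕ → Fin mdim → ℝ) (y : ℕ → Fin pdim → ℝ) : Prop :=
  ∃ x : ℕ → Fin n → ℝ, ∀ t, t < T →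
    x (t + 1) = A.mulVec (x t) + B.mulVec (u t) ∧
    y t = C.mulVec (x t) + D.mulVec (u t)

/-- Block Hankel matrix of depth `s` built from the `Nd` data points
`x(0), …, x(Nd − 1)`: the `(i, j)` block entry (each block in `ℝ^q`) is `x(i + j)`. -/
def hankel (q s Nd : ℕ) (x : ℕ → Fin q → ℝ) :
    Matrix (Fin s × Fin q) (Fin (Nd - s + 1)) ℝ :=
  fun r j => x ((r.1 : ℕ) + (j : ℕ)) r.2

/-- Observability matrix of depth `l`: `col(C, CA, …, CA^{l−1})`. -/
def obsMatrix {n pdim : ℕ} (A : Matrix (Fin n) (Fin n) ℝ)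
    (C : Matrix (Fin pdim) (Fin n) ℝ) (l : ℕ) : Matrix (Fin l × Fin pdim) (Fin n) ℝ :=
  fun r j => (C * A ^ (r.1 : ℕ)) r.2 j

/-- A matrix of full column rank has trivial kernel. -/
theorem eq_zero_of_mulVec_eq_zero_of_rank_eq {ι : Type*} [Fintype ι] {n : ℕ}
    {M : Matrix ι (Fin n) ℝ} (hM : M.rank = n) {v : Fin n → ℝ} (hv : M.mulVec v = 0) :
    v = 0 := by
  have h := M.mulVecLin.finrank_range_add_finrank_ker
  have hr : Module.finrank ℝ (LinearMap.range M.mulVecLin) = n := hM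
  rw [hr, Module.finrank_fin_fun] at h
  have hker : LinearMap.ker M.mulVecLin = ⊥ := Submodule.finrank_eq_zero.mp (by omega)
  exact LinearMap.ker_eq_bot'.mp hker v hv

theorem obsMatrix_mulVec_apply {n pdim : ℕ} (A : Matrix (Fin n) (Fin n) ℝ)
    (C : Matrix (Fin pdim) (Fin n) ℝ) (l : ℕ) (v : Fin n → ℝ) (r : Fin l × Fin pdim) :
    (obsMatrix A C l).mulVec v r = C.mulVec ((A ^ (r.1 : ℕ)).mulVec v) r.2 := by
  rw [Matrix.mulVec_mulVec]
  rfl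

/-- A state sequence of the autonomous system `x(t+1) = A x(t)` is `x(t) = A ^ t x(0)`. -/
theorem state_eq_pow_mulVec {n : ℕ} {A : Matrix (Fin n) (Fin n) ℝ} {T : ℕ}
    {x : ℕ → Fin n → ℝ} (hx : ∀ t, t < T → x (t + 1) = A.mulVec (x t)) :
    ∀ t, t ≤ T → x t = (A ^ t).mulVec (x 0) := by
  intro t
  induction t with
  | zero => simp
  | succ t ih =>
    intro ht
    rw [hx t (by omega), ih (by omega), Matrix.mulVec_mulVec, pow_succ']

section

variable {n mdim pdim : ℕ} {A : Matrix (Fin n) (Fin n) ℝ} {B : Matrix (Fin n) (Fin mdim) ℝ}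
  {C : Matrix (Fin pdim) (Fin n) ℝ} {D : Matrix (Fin pdim) (Fin mdim) ℝ}

/-- For an observable system, trajectories with the same inputs whose outputs agree on an
initial window at least as long as the lag have the same outputs throughout. -/
theorem IsTrajectory.output_unique {l T : ℕ} (hobs : (obsMatrix A C l).rank = n)
    (hl : l ≤ T) {u u' : ℕ → Fin mdim → ℝ} {y y' : ℕ → Fin pdim → ℝ}
    (h : IsTrajectory A B C D T u y) (h' : IsTrajectory A B C D T u' y')
    (hu : ∀ t, t < T → u t = u' t) (hy : ∀ t, t < l → y t = y' t) :
    ∀ t, t < T → y t = y' t := by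
  obtain ⟨x, hx⟩ := h
  obtain ⟨x', hx'⟩ := h'
  have hpow := state_eq_pow_mulVec (A := A) (T := T) (x := fun t => x t - x' t) fun t ht => by
    rw [(hx t ht).1, (hx' t ht).1, hu t ht, Matrix.mulVec_sub, add_sub_add_right_eq_sub]
  have hout : ∀ t, t < T → y t - y' t = C.mulVec (x t - x' t) := fun t ht => by
    rw [(hx t ht).2, (hx' t ht).2, hu t ht, Matrix.mulVec_sub, add_sub_add_right_eq_sub]
  have hzero : x 0 - x' 0 = 0 := by
    refine eq_zero_of_mulVec_eq_zero_of_rank_eq hobs (funext fun r => ?_)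
    have hr := r.1.isLt
    rw [obsMatrix_mulVec_apply, ← hpow r.1 (by omega), ← hout r.1 (by omega), hy r.1 hr,
      sub_self]
    rfl
  intro t ht
  rw [← sub_eq_zero, hout t ht, hpow t ht.le, hzero, Matrix.mulVec_zero, Matrix.mulVec_zero]

/-- Linear combinations of time-shifted windows of a trajectory are trajectories. -/
theorem IsTrajectory.sum_smul_shift {N T k : ℕ} {u : ℕ → Fin mdim → ℝ} {y : ℕ → Fin pdim → ℝ}
    (h : IsTrajectory A B C D N u y) (hk : T + k ≤ N + 1) (g : Fin k → ℝ) :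
    IsTrajectory A B C D T (fun t => ∑ j, g j • u (t + j)) (fun t => ∑ j, g j • y (t + j)) := by
  obtain ⟨x, hx⟩ := h
  refine ⟨fun t => ∑ j, g j • x (t + j), fun t ht => ?_⟩
  have hlt : ∀ j : Fin k, t + (j : ℕ) < N := fun j => by omega
  simp only [Matrix.mulVec_sum, Matrix.mulVec_smul, ← Finset.sum_add_distrib, ← smul_add]
  refine ⟨Finset.sum_congr rfl fun j _ => ?_, Finset.sum_congr rfl fun j _ => ?_⟩
  · rw [add_right_comm, (hx _ (hlt j)).1]
  · rw [(hx _ (hlt j)).2]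

end

theorem hankel_mulVec_apply (q s Nd : ℕ) (x : ℕ → Fin q → ℝ) (g : Fin (Nd - s + 1) → ℝ)
    (r : Fin s × Fin q) :
    (hankel q s Nd x).mulVec g r = (∑ j, g j • x (r.1 + j)) r.2 := by
  simp [Matrix.mulVec, dotProduct, hankel, Finset.sum_apply, mul_comm]

/-- Uniqueness of the future output in the data-driven representation: (i) every `g`
matching the past inputs/outputs and future inputs also matches the future outputs;
(ii) two trajectories with the same past inputs/outputs and future inputs have the
same future outputs. Here `ℓ` is the lag of the (observable) system and `Lp ≥ ℓ`. -/
theorem future_output_uniqueness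
    (n mdim pdim Lp Lf Nd ℓ : ℕ) (hLp : 1 ≤ Lp) (hLf : 1 ≤ Lf)
    (A : Matrix (Fin n) (Fin n) ℝ) (B : Matrix (Fin n) (Fin mdim) ℝ)
    (C : Matrix (Fin pdim) (Fin n) ℝ) (D : Matrix (Fin pdim) (Fin mdim) ℝ)
    (hobs : (obsMatrix A C ℓ).rank = n)
    (hlag : ∀ l : ℕ, (obsMatrix A C l).rank = n → ℓ ≤ l)
    (hLpℓ : ℓ ≤ Lp)
    (ud : ℕ → Fin mdim → ℝ) (yd : ℕ → Fin pdim → ℝ)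
    (hNd : Lp + Lf ≤ Nd)
    (hdata : IsTrajectory A B C D Nd ud yd) :
    (∀ (u : ℕ → Fin mdim → ℝ) (y : ℕ → Fin pdim → ℝ),
      IsTrajectory A B C D (Lp + Lf) u y →
      ∀ g : Fin (Nd - (Lp + Lf) + 1) → ℝ,
        (∀ r : Fin (Lp + Lf) × Fin mdim, (r.1 : ℕ) < Lp →
          (hankel mdim (Lp + Lf) Nd ud).mulVec g r = u r.1 r.2) →
        (∀ r : Fin (Lp + Lf) × Fin pdim, (r.1 : ℕ) < Lp →
          (hankel pdim (Lp + Lf) Nd yd).mulVec g r = y r.1 r.2) →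
        (∀ r : Fin (Lp + Lf) × Fin mdim, Lp ≤ (r.1 : ℕ) →
          (hankel mdim (Lp + Lf) Nd ud).mulVec g r = u r.1 r.2) →
        ∀ r : Fin (Lp + Lf) × Fin pdim, Lp ≤ (r.1 : ℕ) →
          (hankel pdim (Lp + Lf) Nd yd).mulVec g r = y r.1 r.2) ∧
    (∀ (u y u' y'),
      IsTrajectory A B C D (Lp + Lf) u y → IsTrajectory A B C D (Lp + Lf) u' y' →
      (∀ t, t < Lp → u t = u' t) → (∀ t, t < Lp → y t = y' t) →
      (∀ t, Lp ≤ t → t < Lp + Lf → u t = u' t) →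
      ∀ t, Lp ≤ t → t < Lp + Lf → y t = y' t) := by
  constructor
  · intro u y h g hup hyp huf r _
    rw [hankel_mulVec_apply]
    refine congrFun (IsTrajectory.output_unique hobs (by omega)
      (hdata.sum_smul_shift (by omega) g) h (fun t ht => funext fun i => ?_)
      (fun t ht => funext fun i => ?_) r.1 r.1.isLt) r.2
    · rw [← hankel_mulVec_apply mdim (Lp + Lf) Nd ud g (⟨t, ht⟩, i)]
      rcases lt_or_ge t Lp with htp | htp
      · exact hup (⟨t, ht⟩, i) htp
      · exact huf (⟨t, ht⟩, i) htp
    · rw [← hankel_mulVec_apply pdim (Lp + Lf) Nd yd g (⟨t, by omega⟩, i)]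
      exact hyp (⟨t, by omega⟩, i) (by simp only; omega)
  · intro u y u' y' h h' hup hyp huf t _ ht
    refine IsTrajectory.output_unique hobs (by omega) h h' (fun t ht => ?_)
      (fun t ht => hyp t (by omega)) t ht
    rcases lt_or_ge t Lp with htp | htp
    · exact hup t htp
    · exact huf t htp ht
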